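/- If f : ℝ^m → ℝ^n is a topological embedding witnessed by a continuous left inverse, i.e., there are continuous maps f : ℝ^m → ℝ^n and g defined on f[ℝ^m] with g ∘ f = id, then m ≤ n. -/

import Mathlib

open Set Metric MeasureTheory Module Polynomial
open scoped NNReal

lemma LinearMap.exists_polynomial_eval_eq_det_one_add_smul {K V : Type*} [Field K]
    [AddCommGroup V] [Module K V] [FiniteDimensional K V] (A : V →ₗ[K] V) :
    ∃ p : K[X], p.natDegree ≤ finrank K V ∧ ∀ t, p.eval t = LinearMap.det (1 + t • A) := by
  let b := finBasis K V
  refine ⟨_, (natDegree_det_X_add_C_le (LinearMap.toMatrix b b A) 1).trans_eq (by simp), ?_⟩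
  intro t
  rw [← LinearMap.det_toMatrix b, ← coe_evalRingHom, RingHom.map_det]
  congr 1
  ext i j
  by_cases hij : i = j
  · simp [hij, add_comm, mul_comm t]
  · simp [hij, mul_comm t]

/-- Extrapolation of polynomials of bounded degree from prescribed nodes. -/
lemma Polynomial.exists_eval_eq_sum_weights {K : Type*} [Field K] (d : ℕ) {v : ℕ → K}
    (hv : Function.Injective v) (a : K) :
    ∃ w : ℕ → K, ∀ p : K[X], p.natDegree ≤ d →
      p.eval a = ∑ i ∈ Finset.range (d + 1), w i * p.eval (v i) := by
  refine ⟨fun i ↦ (Lagrange.basis (Finset.range (d + 1)) v i).eval a, fun p hp ↦ ?_⟩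
  have hdeg : p.degree < (Finset.range (d + 1)).card := by
    rw [Finset.card_range]
    exact (degree_le_of_natDegree_le hp).trans_lt (by exact_mod_cast d.lt_succ_self)
  conv_lhs => rw [Lagrange.eq_interpolate hv.injOn hdeg, Lagrange.interpolate_apply]
  simp [eval_finsetSum, mul_comm]

lemma LipschitzOnWith.indicator_closedBall {E F : Type*} [NormedAddCommGroup E] [NormedSpace ℝ E]
    [NormedAddCommGroup F] {u : E → F} {L : ℝ≥0} (hu : LipschitzOnWith L u (closedBall 0 1))
    (hu0 : ∀ x, ‖x‖ = 1 → u x = 0) : LipschitzWith L ((closedBall 0 1).indicator u) := by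
  have key : ∀ x y : E, ‖x‖ ≤ 1 → 1 < ‖y‖ → dist (u x) 0 ≤ L * dist x y := by
    intro x y hx hy
    obtain ⟨z, hz, hz1⟩ := (convex_segment (𝕜 := ℝ) x y).isPreconnected.intermediate_value
      (left_mem_segment ℝ x y) (right_mem_segment ℝ x y)
      (continuous_norm.continuousOn) (show (1 : ℝ) ∈ Icc ‖x‖ ‖y‖ from ⟨hx, hy.le⟩)
    have hxz := dist_add_dist_of_mem_segment hz
    calc dist (u x) 0 = dist (u x) (u z) := by rw [hu0 z hz1]
      _ ≤ L * dist x z := hu.dist_le_mul _ (by simpa using hx) _ (by simpa using hz1.le)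
      _ ≤ L * dist x y := by gcongr; linarith [dist_nonneg (x := z) (y := y)]
  refine LipschitzWith.of_dist_le_mul fun x y ↦ ?_
  by_cases hx : ‖x‖ ≤ 1 <;> by_cases hy : ‖y‖ ≤ 1
  · simpa [hx, hy] using hu.dist_le_mul x (by simpa using hx) y (by simpa using hy)
  · simpa [hx, hy, dist_comm] using key x y hx (not_le.1 hy)
  · simpa [hx, hy, dist_comm] using key y x hy (not_le.1 hx)
  · simp only [mem_closedBall, dist_zero_right, hx, hy, not_false_eq_true, indicator_of_notMem,
      dist_self]
    positivity

section

variable {E : Type*} [NormedAddCommGroup E] [NormedSpace ℝ E] [CompleteSpace E]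

lemma image_closedBall_add_of_lipschitz {u : E → E} {L : ℝ≥0} (hL : L < 1)
    (hu : LipschitzOnWith L u (closedBall 0 1)) (hu0 : ∀ x, ‖x‖ = 1 → u x = 0) :
    InjOn (fun x ↦ x + u x) (closedBall 0 1) ∧
      (fun x ↦ x + u x) '' closedBall 0 1 = closedBall 0 1 := by
  set w := (closedBall 0 1).indicator u with hw
  have happ : ApproximatesLinearOn (fun x ↦ x + w x)
      (ContinuousLinearEquiv.refl ℝ E : E →L[ℝ] E) univ L := by
    rw [ApproximatesLinearOn.approximatesLinearOn_iff_lipschitzOnWith, lipschitzOnWith_univ]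
    convert! hu.indicator_closedBall hu0 using 1
    ext x
    simp [hw]
  have hN : Subsingleton E ∨
      L < ‖((ContinuousLinearEquiv.refl ℝ E).symm : E →L[ℝ] E)‖₊⁻¹ := by
    rcases subsingleton_or_nontrivial E with h | h
    · exact .inl h
    · right
      simpa using hL
  have hbij : Function.Bijective (fun x ↦ x + w x) :=
    ⟨injOn_univ.1 (happ.injOn hN), happ.surjective hN⟩
  have heq : EqOn (fun x ↦ x + w x) (fun x ↦ x + u x) (closedBall 0 1) := fun x hx ↦ by
    simp only [hw, indicator_of_mem hx]
  have hout : (fun x ↦ x + w x) '' (closedBall 0 1)ᶜ = (closedBall 0 1)ᶜ := by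
    refine (image_congr fun x hx ↦ ?_).trans (image_id _)
    simp only [hw, indicator_of_notMem hx, add_zero, id]
  refine ⟨heq.injOn_iff.1 hbij.1.injOn, ?_⟩
  rw [← heq.image_eq]
  rwa [image_compl_eq hbij, compl_inj_iff] at hout

end

section

variable {E : Type*} [NormedAddCommGroup E] [NormedSpace ℝ E] [FiniteDimensional ℝ E]
  [MeasurableSpace E] [BorelSpace E] (μ : Measure E) [μ.IsAddHaarMeasure]

lemma exists_forall_integral_det_eq_of_small {u : E → E} (hu : ContDiff ℝ 1 u)
    (hu0 : ∀ x, ‖x‖ = 1 → u x = 0) :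
    ∃ t₀ > (0 : ℝ), ∀ t ∈ Ioo 0 t₀,
      ∫ x in closedBall (0 : E) 1, (1 + t • fderiv ℝ u x).det ∂μ = μ.real (closedBall 0 1) := by
  have hcont : Continuous (fderiv ℝ u) := hu.continuous_fderiv (by simp)
  obtain ⟨C, hC⟩ := (isCompact_closedBall (0 : E) 1).exists_bound_of_continuousOn hcont.continuousOn
  obtain ⟨L, hCL, hL0⟩ : ∃ L : ℝ≥0, C ≤ L ∧ 0 < L :=
    ⟨C.toNNReal + 1, (Real.le_coe_toNNReal C).trans (by simp), by positivity⟩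
  have hL : ∀ x ∈ closedBall (0 : E) 1, ‖fderiv ℝ u x‖₊ ≤ L := fun x hx ↦ (hC x hx).trans hCL
  have hlip : LipschitzOnWith L u (closedBall 0 1) :=
    (convex_closedBall (0 : E) 1).lipschitzOnWith_of_nnnorm_fderiv_le
      (fun x _ ↦ hu.differentiable (by simp) x) hL
  obtain ⟨δ, hδ, hdet⟩ : ∃ δ > 0, ∀ A : E →L[ℝ] E, dist A 1 < δ → 0 < A.det :=
    Metric.eventually_nhds_iff.1 <| (ContinuousLinearMap.continuous_det.tendsto
      (1 : E →L[ℝ] E)).eventually_const_lt (by simp [ContinuousLinearMap.det])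
  have hL0' : (0 : ℝ) < L := hL0
  refine ⟨min 1 δ / L, by positivity, fun t ht ↦ ?_⟩
  have htL : t * L < min 1 δ := (lt_div_iff₀ hL0').1 ht.2
  have hpos : ∀ x ∈ closedBall (0 : E) 1, 0 < (1 + t • fderiv ℝ u x).det := fun x hx ↦ by
    refine hdet _ ?_
    rw [dist_eq_norm, add_sub_cancel_left, norm_smul, Real.norm_of_nonneg ht.1.le]
    calc t * ‖fderiv ℝ u x‖ ≤ t * L := by
          gcongr
          · exact ht.1.le
          · exact hL x hx
      _ < δ := htL.trans_le (min_le_right _ _)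
  have hlip' : LipschitzOnWith (‖t‖₊ * L) (fun x ↦ t • u x) (closedBall 0 1) :=
    (lipschitzWith_smul t).comp_lipschitzOnWith hlip
  obtain ⟨hinj, himg⟩ := image_closedBall_add_of_lipschitz (by
    rw [← NNReal.coe_lt_coe]
    simpa [abs_of_pos ht.1] using htL.trans_le (min_le_left _ _)) hlip'
    (fun x hx ↦ by simp [hu0 x hx])
  have hderiv : ∀ x ∈ closedBall (0 : E) 1, HasFDerivWithinAt (fun x ↦ x + t • u x)
      (1 + t • fderiv ℝ u x) (closedBall 0 1) x := fun x _ ↦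
    ((hasFDerivAt_id x).add
      ((hu.differentiable (by simp) x).hasFDerivAt.const_smul t)).hasFDerivWithinAt
  have hcv := integral_image_eq_integral_abs_det_fderiv_smul μ measurableSet_closedBall hderiv hinj
    (fun _ ↦ (1 : ℝ))
  rw [himg] at hcv
  simp only [integral_const, measureReal_restrict_apply_univ, smul_eq_mul, mul_one] at hcv
  rw [hcv]
  exact setIntegral_congr_fun measurableSet_closedBall fun x hx ↦ (abs_of_pos (hpos x hx)).symm

lemma integral_det_one_add_fderiv_closedBall {u : E → E} (hu : ContDiff ℝ 1 u)
    (hu0 : ∀ x, ‖x‖ = 1 → u x = 0) :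
    ∫ x in closedBall (0 : E) 1, (1 + fderiv ℝ u x).det ∂μ = μ.real (closedBall 0 1) := by
  obtain ⟨t₀, ht₀, hsmall⟩ := exists_forall_integral_det_eq_of_small μ hu hu0
  let v : ℕ → ℝ := fun i ↦ t₀ / (i + 2)
  have hv : Function.Injective v := fun i j hij ↦ by
    simp only [v] at hij
    field_simp at hij
    exact_mod_cast add_right_cancel hij.symm
  have hvmem : ∀ i, v i ∈ Ioo 0 t₀ := fun i ↦
    ⟨by positivity, div_lt_self ht₀ (by linarith [(i : ℕ).cast_nonneg (α := ℝ)])⟩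
  obtain ⟨w, hw⟩ := exists_eval_eq_sum_weights (finrank ℝ E) hv 1
  have hw1 : ∑ i ∈ Finset.range (finrank ℝ E + 1), w i = 1 := by
    simpa using (hw 1 (by simp)).symm
  have hdet : ∀ A : E →L[ℝ] E, (1 + A).det =
      ∑ i ∈ Finset.range (finrank ℝ E + 1), w i * (1 + v i • A).det := fun A ↦ by
    obtain ⟨p, hp, hpt⟩ := LinearMap.exists_polynomial_eval_eq_det_one_add_smul (A : E →ₗ[ℝ] E)
    have := hw p hp
    simp only [hpt, one_smul] at this
    exact this
  have hcont : Continuous (fderiv ℝ u) := hu.continuous_fderiv (by simp)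
  have hint : ∀ t : ℝ, IntegrableOn (fun x ↦ (1 + t • fderiv ℝ u x).det) (closedBall 0 1) μ :=
    fun t ↦ (ContinuousLinearMap.continuous_det.comp
      (by fun_prop : Continuous fun x ↦ 1 + t • fderiv ℝ u x)).continuousOn.integrableOn_compact
      (isCompact_closedBall 0 1)
  simp only [fun x ↦ hdet (fderiv ℝ u x)]
  rw [integral_finsetSum _ fun i _ ↦ (hint (v i)).const_mul (w i)]
  simp_rw [integral_const_mul, hsmall _ (hvmem _)]
  rw [← Finset.sum_mul, hw1, one_mul]

end

section

variable {E : Type*} [NormedAddCommGroup E] [InnerProductSpace ℝ E] [FiniteDimensional ℝ E]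

lemma det_fderiv_eq_zero_of_norm_eq_one {r : E → E} (hr : Differentiable ℝ r)
    (hr1 : ∀ x, ‖r x‖ = 1) (x : E) : (fderiv ℝ r x).det = 0 := by
  by_contra h
  have hunit : IsUnit (fderiv ℝ r x : E →ₗ[ℝ] E) :=
    (LinearMap.isUnit_iff_isUnit_det _).2 (isUnit_iff_ne_zero.2 h)
  obtain ⟨w, hw⟩ := ((Module.End.isUnit_iff _).1 hunit).2 (r x)
  have hconst : HasFDerivAt (fun y ↦ inner ℝ (r y) (r y)) (0 : E →L[ℝ] ℝ) x := by
    simp only [real_inner_self_eq_norm_sq, hr1]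
    exact hasFDerivAt_const _ _
  have hd := (hr x).hasFDerivAt.inner ℝ (hr x).hasFDerivAt
  have := congr($(hd.unique hconst) w)
  simp only [ContinuousLinearMap.coe_coe] at hw
  simp [hw, hr1] at this

/-- There is no `C¹` retraction onto the unit sphere. -/
theorem not_exists_contDiff_retraction_sphere {r : E → E} (hr : ContDiff ℝ 1 r)
    (hr1 : ∀ x, ‖r x‖ = 1) : ¬ ∀ x, ‖x‖ = 1 → r x = x := by
  intro hfix
  borelize E
  have hu : ContDiff ℝ 1 (fun x ↦ r x - x) := hr.sub contDiff_id
  have hI := integral_det_one_add_fderiv_closedBall Measure.addHaar hu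
    (fun x hx ↦ by simp [hfix x hx])
  have hfd : ∀ x, 1 + fderiv ℝ (fun x ↦ r x - x) x = fderiv ℝ r x := fun x ↦ by
    have := ((hr.differentiable (by simp) x).hasFDerivAt.sub (hasFDerivAt_id x)).fderiv
    exact (congrArg (1 + ·) this).trans (add_sub_cancel _ _)
  simp only [hfd, det_fderiv_eq_zero_of_norm_eq_one (hr.differentiable (by simp)) hr1,
    integral_zero] at hI
  exact (ENNReal.toReal_pos (measure_closedBall_pos _ _ one_pos).ne'
    measure_closedBall_lt_top.ne).ne hI

/-- A continuous self-map that is the identity away from a compact part of the open unit ball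
has a zero. -/
theorem exists_eq_zero_of_eq_id_outside {φ : E → E} (hφ : Continuous φ) {ρ : ℝ} (hρ : ρ < 1)
    (hid : ∀ x, ρ ≤ ‖x‖ → φ x = x) : ∃ x, φ x = 0 := by
  by_contra! h0
  have hU : {x : E | ρ < ‖x‖} ∈ nhdsSet {x : E | 1 ≤ ‖x‖} :=
    (isOpen_lt continuous_const continuous_norm).mem_nhdsSet.2 fun x hx ↦ hρ.trans_le hx
  obtain ⟨ψ, hψ, hclose, heq, -⟩ := hφ.exists_contDiff_approx_and_eqOn 1
    hφ.norm (fun x ↦ norm_pos_iff.2 (h0 x)) (isClosed_le continuous_const continuous_norm) hU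
    (contDiffOn_id.congr fun x hx ↦ hid x (le_of_lt hx))
  have hψ0 : ∀ x, ψ x ≠ 0 := fun x hx ↦ by simpa [hx] using hclose x
  refine not_exists_contDiff_retraction_sphere (r := fun x ↦ ‖ψ x‖⁻¹ • ψ x)
    (((hψ.norm ℝ hψ0).inv fun x ↦ norm_ne_zero_iff.2 (hψ0 x)).smul hψ)
    (fun x ↦ by simp [norm_smul, hψ0 x]) fun x hx ↦ ?_
  have : ψ x = x := (heq hx.ge).trans (hid x (hρ.le.trans hx.ge))
  simp [this, hx]

/-- A continuous map that is close to the identity on the unit ball has a zero. -/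
theorem exists_eq_zero_of_norm_sub_lt {φ : E → E} (hφ : Continuous φ)
    (hclose : ∀ x, ‖x‖ ≤ 1 → ‖φ x - x‖ < 1 / 2) : ∃ x, φ x = 0 := by
  let χ : E → ℝ := fun x ↦ max 0 (min 1 (3 - 4 * ‖x‖))
  have hχ : Continuous χ := by fun_prop
  have hχ0 : ∀ x, 0 ≤ χ x := fun x ↦ le_max_left _ _
  have hχ1 : ∀ x, χ x ≤ 1 := fun x ↦ max_le zero_le_one (min_le_left _ _)
  have hχout : ∀ x, 3 / 4 ≤ ‖x‖ → χ x = 0 := fun x hx ↦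
    max_eq_left ((min_le_right _ _).trans (by linarith))
  have hχin : ∀ x, ‖x‖ ≤ 1 / 2 → χ x = 1 := fun x hx ↦ by
    simp only [χ]
    rw [min_eq_left (by linarith), max_eq_right zero_le_one]
  obtain ⟨x, hx⟩ := exists_eq_zero_of_eq_id_outside (φ := fun x ↦ x + χ x • (φ x - x))
    (by fun_prop) (by norm_num : (3 / 4 : ℝ) < 1) (fun x hx ↦ by simp [hχout x hx])
  by_cases hx2 : ‖x‖ ≤ 1 / 2
  · exact ⟨x, by simpa [hχin x hx2] using hx⟩
  · exfalso
    push Not at hx2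
    by_cases hx1 : ‖x‖ ≤ 1
    · have h1 : ‖x‖ = ‖χ x • (φ x - x)‖ := by
        rw [← norm_neg, neg_eq_of_add_eq_zero_right hx]
      rw [norm_smul, Real.norm_of_nonneg (hχ0 x)] at h1
      nlinarith [hclose x hx1, norm_nonneg (φ x - x), hχ1 x]
    · rw [hχout x (by linarith), zero_smul, add_zero] at hx
      norm_num [hx] at hx2

variable {F : Type*} [NormedAddCommGroup F] [NormedSpace ℝ F] [FiniteDimensional ℝ F]

theorem finrank_le_of_continuous_leftInverse_on_closedBall {f : E → F} {G : F → E}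
    (hf : Continuous f) (hG : Continuous G) (hGf : ∀ x, ‖x‖ ≤ 1 → G (f x) = x) :
    finrank ℝ E ≤ finrank ℝ F := by
  by_contra! hlt
  obtain ⟨P, hP, hPG, -⟩ := hG.exists_contDiff_approx 1 (ε := fun _ ↦ 1 / 4)
    continuous_const (fun _ ↦ by norm_num)
  obtain ⟨c, hc, hcP⟩ := (hP.dense_compl_range_of_finrank_lt_finrank hlt).exists_dist_lt 0
    (by norm_num : (0 : ℝ) < 1 / 4)
  obtain ⟨x, hx⟩ := exists_eq_zero_of_norm_sub_lt (φ := fun x ↦ P (f x) - c)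
    ((hP.continuous.comp hf).sub continuous_const) fun x hx ↦ by
      have h1 := hPG (f x)
      rw [hGf x hx, dist_eq_norm] at h1
      rw [dist_zero_left] at hcP
      calc ‖P (f x) - c - x‖ = ‖(P (f x) - x) - c‖ := by congr 1; abel
        _ ≤ ‖P (f x) - x‖ + ‖c‖ := norm_sub_le _ _
        _ < 1 / 2 := by linarith
  exact hc ⟨f x, sub_eq_zero.1 hx⟩

end

/-- If `f : ℝ^m → ℝ^n` is continuous and admits a continuous left inverse `g`
defined on the image of `f`, then `m ≤ n`. -/
theorem stmt_3 (m n : ℕ) (f : (Fin m → ℝ) → (Fin n → ℝ))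
    (g : (Fin n → ℝ) → (Fin m → ℝ))
    (hf : Continuous f) (hg : ContinuousOn g (Set.range f))
    (hgf : ∀ x, g (f x) = x) : m ≤ n := by
  let e : EuclideanSpace ℝ (Fin m) ≃L[ℝ] (Fin m → ℝ) := EuclideanSpace.equiv (Fin m) ℝ
  let s : Set (Fin n → ℝ) := (f ∘ e) '' closedBall 0 1
  have hfe : Continuous (f ∘ e) := hf.comp e.continuous
  have hs : IsClosed s := ((isCompact_closedBall _ _).image hfe).isClosed
  have hgs : ContinuousOn g s := hg.mono (by rintro _ ⟨x, -, rfl⟩; exact ⟨e x, rfl⟩)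
  obtain ⟨G, hG⟩ := ContinuousMap.exists_restrict_eq hs ⟨s.domRestrict g, hgs.domRestrict⟩
  have hGg : ∀ y ∈ s, G y = g y := fun y hy ↦ congr($hG ⟨y, hy⟩)
  simpa using finrank_le_of_continuous_leftInverse_on_closedBall hfe
    (e.symm.continuous.comp G.continuous) fun x hx ↦ by
      have := hGg (f (e x)) ⟨x, by simpa using hx, rfl⟩
      simp [this, hgf]
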